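/- Fix an integer k ≥ 2, an integer i with 0 ≤ i ≤ k, a constant C_BH > 0, and constants C_F, c₁, c₂ > 0. There exists C > 0, depending only on k, i, C_BH, C_F, c₁, c₂, with the following property: for every h ∈ (0,1], every map F : ℝ² → ℝ² with polynomial components of total degree ≤ k satisfying the isoparametric bounds of order k (with constants C_F, c₁, c₂ and parameter h), every v̂ : ℝ² → ℝ² with polynomial components of total degree ≤ k, every index j ∈ {1,2,3}, and every function ŵ : ℝ² → ℝ² with polynomial components of total degree ≤ k satisfying ‖A v̂ − ŵ‖_{H^i(K̂ⱼ)} ≤ C_BH |A v̂|_{H^{k+1}(K̂ⱼ)} (where (A v̂)(x̂) := A(x̂)v̂(x̂) with A(x̂) := DF(x̂)/det DF(x̂)), the Piola transform v of v̂ under F and the function w := ŵ ∘ F⁻¹ satisfy |v − w|_{H^i(F(K̂ⱼ))} ≤ C h^{k+1−i} ‖v‖_{H^k(F(K̂ⱼ))}. -/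

import Mathlib

open Set MeasureTheory Function

noncomputable section

/-- The open reference triangle with vertices (0,0), (1,0), (0,1). -/
def Tref : Set (ℝ × ℝ) := {x | 0 < x.1 ∧ 0 < x.2 ∧ x.1 + x.2 < 1}

/-- The three vertices of the reference triangle. -/
def vtx : Fin 3 → ℝ × ℝ := ![(0, 0), (1, 0), (0, 1)]

/-- The (open) Clough–Tocher subtriangles, obtained by connecting the barycenter
to the vertices. -/
def ctK (i : Fin 3) : Set (ℝ × ℝ) :=
  interior (convexHull ℝ {vtx i, vtx (i + 1), ((1 : ℝ) / 3, (1 : ℝ) / 3)})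

/-- A map `ℝ² → ℝ²` whose two components are polynomials of total degree ≤ k. -/
def IsPolyMap (k : ℕ) (F : ℝ × ℝ → ℝ × ℝ) : Prop :=
  ∃ P Q : MvPolynomial (Fin 2) ℝ, P.totalDegree ≤ k ∧ Q.totalDegree ≤ k ∧
    ∀ x : ℝ × ℝ,
      F x = (MvPolynomial.eval ![x.1, x.2] P, MvPolynomial.eval ![x.1, x.2] Q)

/-- The Jacobian determinant of `F`. -/
def jacDet (F : ℝ × ℝ → ℝ × ℝ) (x : ℝ × ℝ) : ℝ :=
  LinearMap.det ((fderiv ℝ F x) : (ℝ × ℝ) →ₗ[ℝ] (ℝ × ℝ))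

/-- The Piola matrix `A(x) = DF(x) / det DF(x)`. -/
def Amap (F : ℝ × ℝ → ℝ × ℝ) (x : ℝ × ℝ) : (ℝ × ℝ) →L[ℝ] (ℝ × ℝ) :=
  (jacDet F x)⁻¹ • fderiv ℝ F x

/-- `B(x) = det DF(x) · (DF(x))⁻¹`, the adjugate of `DF`. -/
def Bmap (F : ℝ × ℝ → ℝ × ℝ) (x : ℝ × ℝ) : (ℝ × ℝ) →L[ℝ] (ℝ × ℝ) :=
  jacDet F x • Ring.inverse (fderiv ℝ F x)

/-- `v` is the Piola transform of `v̂` under `F`. -/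
def IsPiola (F vh v : ℝ × ℝ → ℝ × ℝ) : Prop :=
  ∀ x ∈ closure Tref, v (F x) = Amap F x (vh x)

/-- The `W^{m,p}` seminorm over a set `S` (for `p < ∞`). -/
def semiLp {E : Type*} [NormedAddCommGroup E] [NormedSpace ℝ E]
    (m : ℕ) (p : ℝ) (w : ℝ × ℝ → E) (S : Set (ℝ × ℝ)) : ℝ :=
  (∫ x in S, ‖iteratedFDeriv ℝ m w x‖ ^ p) ^ (1 / p)

/-- The `W^{m,p}` norm over a set `S`: the sum of the seminorms up to order `m`. -/
def normWmp {E : Type*} [NormedAddCommGroup E] [NormedSpace ℝ E]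
    (m : ℕ) (p : ℝ) (w : ℝ × ℝ → E) (S : Set (ℝ × ℝ)) : ℝ :=
  ∑ j ∈ Finset.range (m + 1), semiLp j p w S

/-- The isoparametric bounds of order `k` with constants `CF, c₁, c₂` and parameter `h`. -/
def IsoparamBounds (k : ℕ) (CF c₁ c₂ h : ℝ) (F : ℝ × ℝ → ℝ × ℝ) : Prop :=
  InjOn F (closure Tref) ∧
  (∀ m : ℕ, m ≤ k → ∀ x ∈ Tref, ‖iteratedFDeriv ℝ m F x‖ ≤ CF * h ^ m) ∧
  (∀ m : ℕ, m ≤ k + 1 → ∀ y ∈ F '' Tref,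
    ‖iteratedFDeriv ℝ m (invFunOn F (closure Tref)) y‖ ≤ CF * h ^ (-(m : ℤ))) ∧
  (∀ x ∈ closure Tref, c₁ * h ^ 2 ≤ jacDet F x ∧ jacDet F x ≤ c₂ * h ^ 2)

/-- The (planar) divergence of a vector field. -/
def pdiv (w : ℝ × ℝ → ℝ × ℝ) (x : ℝ × ℝ) : ℝ :=
  (fderiv ℝ w x (1, 0)).1 + (fderiv ℝ w x (0, 1)).2

open scoped Topology ContDiff Nat

section general
variable {E F G H : Type*} [NormedAddCommGroup E] [NormedSpace ℝ E]
  [NormedAddCommGroup F] [NormedSpace ℝ F] [NormedAddCommGroup G] [NormedSpace ℝ G]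
  [NormedAddCommGroup H] [NormedSpace ℝ H]

lemma exists_open_contDiffOn {n : ℕ} {f : E → F} {x : E} (hf : ContDiffAt ℝ n f x) :
    ∃ u : Set E, IsOpen u ∧ x ∈ u ∧ ContDiffOn ℝ n f u := by
  obtain ⟨u, hu, hfu⟩ := hf.contDiffOn (m := (n : ℕ)) le_rfl (by simp)
  obtain ⟨t, ht, hto, hxt⟩ := mem_nhds_iff.1 (by simpa using hu)
  exact ⟨t, hto, hxt, hfu.mono (by simpa using ht)⟩

lemma comp_le_at {n : ℕ} {g : F → G} {f : E → F} {x : E} (hg : ContDiffAt ℝ n g (f x))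
    (hf : ContDiffAt ℝ n f x) {C D : ℝ}
    (hC : ∀ i, i ≤ n → ‖iteratedFDeriv ℝ i g (f x)‖ ≤ C)
    (hD : ∀ i, 1 ≤ i → i ≤ n → ‖iteratedFDeriv ℝ i f x‖ ≤ D ^ i) :
    ‖iteratedFDeriv ℝ n (g ∘ f) x‖ ≤ n ! * C * D ^ n := by
  obtain ⟨t, hto, hxt, hgt⟩ := exists_open_contDiffOn hg
  obtain ⟨u, huo, hxu, hfu⟩ := exists_open_contDiffOn hf
  have hs : IsOpen (u ∩ f ⁻¹' t) := hfu.continuousOn.isOpen_inter_preimage huo hto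
  have hx : x ∈ u ∩ f ⁻¹' t := ⟨hxu, hxt⟩
  rw [← iteratedFDerivWithin_of_isOpen n hs hx]
  refine norm_iteratedFDerivWithin_comp_le hgt (hfu.mono inter_subset_left) le_rfl
    hto.uniqueDiffOn hs.uniqueDiffOn (fun y hy => hy.2) hx ?_ ?_
  · intro i hi
    rw [iteratedFDerivWithin_of_isOpen i hto hxt]; exact hC i hi
  · intro i h1 hi
    rw [iteratedFDerivWithin_of_isOpen i hs hx]; exact hD i h1 hi

lemma bilin_le_at {n : ℕ} (B : F →L[ℝ] G →L[ℝ] H) {f : E → F} {g : E → G} {x : E}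
    (hf : ContDiffAt ℝ n f x) (hg : ContDiffAt ℝ n g x) :
    ‖iteratedFDeriv ℝ n (fun y => B (f y) (g y)) x‖ ≤
      ‖B‖ * ∑ i ∈ Finset.range (n + 1), (n.choose i : ℝ) * ‖iteratedFDeriv ℝ i f x‖ *
        ‖iteratedFDeriv ℝ (n - i) g x‖ := by
  obtain ⟨t, hto, hxt, hgt⟩ := exists_open_contDiffOn hg
  obtain ⟨u, huo, hxu, hfu⟩ := exists_open_contDiffOn hf
  have hs : IsOpen (u ∩ t) := huo.inter hto
  have hx : x ∈ u ∩ t := ⟨hxu, hxt⟩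
  have := B.norm_iteratedFDerivWithin_le_of_bilinear (hfu.mono inter_subset_left)
    (hgt.mono inter_subset_right) hs.uniqueDiffOn hx (n := n) le_rfl
  simpa only [iteratedFDerivWithin_of_isOpen _ hs hx] using this

/-- Scaled derivative bounds at a point: `f` is smooth at `x` and
`‖D^l f(x)‖ ≤ M h^l` for `l ≤ N`. -/
def ScB (N : ℕ) (h M : ℝ) (f : E → F) (x : E) : Prop :=
  ContDiffAt ℝ ∞ f x ∧ ∀ l ≤ N, ‖iteratedFDeriv ℝ l f x‖ ≤ M * h ^ l

lemma ContDiffAt.toNat {f : E → F} {x : E} (hf : ContDiffAt ℝ ∞ f x) (n : ℕ) :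
    ContDiffAt ℝ n f x := hf.of_le (by exact_mod_cast le_top)

lemma ScB.nonneg {N : ℕ} {h M : ℝ} {f : E → F} {x : E} (hf : ScB N h M f x) : 0 ≤ M := by
  have := hf.2 0 (Nat.zero_le _)
  simpa using (norm_nonneg _).trans this

lemma ScB.bilin {N : ℕ} {h M M' : ℝ} (hh : 0 ≤ h) (B : F →L[ℝ] G →L[ℝ] H) {f : E → F} {g : E → G}
    {x : E} (hf : ScB N h M f x) (hg : ScB N h M' g x) :
    ScB N h (‖B‖ * 2 ^ N * M * M') (fun y => B (f y) (g y)) x := by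
  refine ⟨?_, fun l hl => ?_⟩
  · exact (B.contDiff.contDiffAt.comp x hf.1).clm_apply hg.1
  have hM := hf.nonneg
  have hM' := hg.nonneg
  refine (bilin_le_at B (hf.1.toNat l) (hg.1.toNat l)).trans ?_
  have : ∑ i ∈ Finset.range (l + 1), (l.choose i : ℝ) * ‖iteratedFDeriv ℝ i f x‖ *
        ‖iteratedFDeriv ℝ (l - i) g x‖ ≤ ∑ i ∈ Finset.range (l + 1), (l.choose i : ℝ) *
          (M * M' * h ^ l) := by
    refine Finset.sum_le_sum fun i hi => ?_
    have hi' : i ≤ l := by simpa [Nat.lt_succ_iff] using hi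
    have e : M * M' * h ^ l = (M * h ^ i) * (M' * h ^ (l - i)) := by
      rw [← Nat.add_sub_of_le hi', pow_add]; simp; ring
    rw [e, mul_assoc]
    gcongr
    · exact hf.2 i (hi'.trans hl)
    · exact hg.2 _ ((Nat.sub_le _ _).trans hl)
  have h2 : ∑ i ∈ Finset.range (l + 1), (l.choose i : ℝ) * (M * M' * h ^ l) =
      2 ^ l * (M * M' * h ^ l) := by
    rw [← Finset.sum_mul]; congr 1
    exact_mod_cast Nat.sum_range_choose l
  calc _ ≤ ‖B‖ * (2 ^ l * (M * M' * h ^ l)) := by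
        rw [← h2]; gcongr
    _ ≤ ‖B‖ * (2 ^ N * (M * M' * h ^ l)) := by
        gcongr; norm_num
    _ = _ := by ring

lemma ScB.clm {N : ℕ} {h M : ℝ} (L : F →L[ℝ] G) {f : E → F}
    {x : E} (hf : ScB N h M f x) : ScB N h (‖L‖ * M) (fun y => L (f y)) x := by
  refine ⟨L.contDiff.contDiffAt.comp x hf.1, fun l hl => ?_⟩
  refine (L.norm_iteratedFDeriv_comp_left (hf.1.toNat l) le_rfl).trans ?_
  rw [mul_assoc]
  gcongr
  exact hf.2 l hl

lemma ScB.congr {N : ℕ} {h M : ℝ} {f g : E → F}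
    {x : E} (hf : ScB N h M f x) (hfg : g =ᶠ[𝓝 x] f) : ScB N h M g x := by
  refine ⟨hf.1.congr_of_eventuallyEq hfg, fun l hl => ?_⟩
  rw [(hfg.iteratedFDeriv ℝ l).eq_of_nhds]; exact hf.2 l hl

/-- composition `g ∘ f` where the derivatives of `f` scale like `h^l` for `l ≥ 1`. -/
lemma ScB.comp {N : ℕ} {h M D : ℝ} (hh : 0 ≤ h) (hD : 1 ≤ D) {g : F → G} {f : E → F} {x : E}
    (hg : ContDiffAt ℝ ∞ g (f x)) (hgM : ∀ l ≤ N, ‖iteratedFDeriv ℝ l g (f x)‖ ≤ M)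
    (hf : ContDiffAt ℝ ∞ f x) (hfD : ∀ l, 1 ≤ l → l ≤ N → ‖iteratedFDeriv ℝ l f x‖ ≤ D * h ^ l) :
    ScB N h (N ! * D ^ N * M) (g ∘ f) x := by
  refine ⟨hg.comp x hf, fun l hl => ?_⟩
  have hM : 0 ≤ M := (norm_nonneg _).trans (hgM 0 (Nat.zero_le _))
  refine (comp_le_at (C := M) (D := D * h) (hg.toNat l) (hf.toNat l)
    (fun i hi => hgM i (hi.trans hl)) ?_).trans ?_
  · intro i h1 hi
    refine (hfD i h1 (hi.trans hl)).trans ?_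
    rw [mul_pow]
    gcongr
    exact le_self_pow₀ hD (by omega)
  · rw [mul_pow]
    have h1 : (l ! : ℝ) ≤ N ! := by exact_mod_cast Nat.factorial_le hl
    have h2 : D ^ l ≤ D ^ N := pow_le_pow_right₀ hD hl
    calc (l ! : ℝ) * M * (D ^ l * h ^ l) ≤ N ! * M * (D ^ N * h ^ l) := by gcongr
      _ = _ := by ring

end general

/-- smooth with vanishing derivatives of order `> a`. -/
def DegLe {F : Type*} [NormedAddCommGroup F] [NormedSpace ℝ F] (a : ℕ) (f : ℝ × ℝ → F) : Prop :=
  ContDiff ℝ ∞ f ∧ ∀ n, a < n → ∀ x, iteratedFDeriv ℝ n f x = 0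

section deg
variable {F : Type*} [NormedAddCommGroup F] [NormedSpace ℝ F]

lemma DegLe.mono {a b : ℕ} (hab : a ≤ b) {f : ℝ × ℝ → F} (hf : DegLe a f) : DegLe b f :=
  ⟨hf.1, fun n hn x => hf.2 n (hab.trans_lt hn) x⟩

lemma DegLe.const (c : F) : DegLe 0 (fun _ => c) := by
  refine ⟨contDiff_const, fun n hn x => ?_⟩
  rw [iteratedFDeriv_const_of_ne (by omega)]; rfl

lemma DegLe.clm (L : ℝ × ℝ →L[ℝ] F) : DegLe 1 (fun x => L x) := by
  refine ⟨L.contDiff, fun n hn x => ?_⟩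
  obtain ⟨m, rfl⟩ : ∃ m, n = m + 1 := ⟨n - 1, by omega⟩
  have h0 : fderiv ℝ (fun x => L x) = fun _ => L := by
    ext1 y; exact L.fderiv
  rw [← norm_eq_zero, ← norm_iteratedFDeriv_fderiv, h0,
    iteratedFDeriv_const_of_ne (by omega)]
  simp

lemma DegLe.add {a : ℕ} {f g : ℝ × ℝ → F} (hf : DegLe a f) (hg : DegLe a g) :
    DegLe a (fun x => f x + g x) := by
  refine ⟨hf.1.add hg.1, fun n hn x => ?_⟩
  have := iteratedFDeriv_add_apply (hf.1.contDiffAt.toNat n (x := x)) (hg.1.contDiffAt.toNat n)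
  have e : (fun x => f x + g x) = f + g := rfl
  rw [e, this, hf.2 n hn, hg.2 n hn, add_zero]

lemma DegLe.mul {a b : ℕ} {f g : ℝ × ℝ → ℝ} (hf : DegLe a f) (hg : DegLe b g) :
    DegLe (a + b) (fun x => f x * g x) := by
  refine ⟨hf.1.mul hg.1, fun n hn x => ?_⟩
  rw [← norm_le_zero_iff]
  refine (norm_iteratedFDeriv_mul_le hf.1 hg.1 x (n := n) (by exact_mod_cast le_top)).trans ?_
  refine (Finset.sum_eq_zero fun i hi => ?_).le
  by_cases h : a < i
  · rw [hf.2 i h]; simp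
  · rw [hg.2 (n - i) (by omega)]; simp

lemma DegLe.pow {a : ℕ} {f : ℝ × ℝ → ℝ} (hf : DegLe a f) (m : ℕ) :
    DegLe (m * a) (fun x => f x ^ m) := by
  induction m with
  | zero => simpa using DegLe.const (1 : ℝ)
  | succ m ih =>
    simp only [pow_succ]
    rw [add_mul, one_mul]
    exact ih.mul hf

lemma DegLe.sum {ι : Type*} (s : Finset ι) {a : ℕ} (f : ι → ℝ × ℝ → F)
    (hf : ∀ i ∈ s, DegLe a (f i)) : DegLe a (fun x => ∑ i ∈ s, f i x) := by
  classical
  induction s using Finset.induction_on with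
  | empty => simpa using (DegLe.const (0 : F)).mono (Nat.zero_le a)
  | insert i s hi ih =>
    simp only [Finset.sum_insert hi]
    exact (hf i (by simp)).add (ih fun j hj => hf j (by simp [hj]))

lemma DegLe.poly {k : ℕ} (P : MvPolynomial (Fin 2) ℝ) (hP : P.totalDegree ≤ k) :
    DegLe k (fun x : ℝ × ℝ => MvPolynomial.eval ![x.1, x.2] P) := by
  simp only [MvPolynomial.eval_eq']
  refine DegLe.sum _ _ fun d hd => ?_
  have h1 : d 0 + d 1 ≤ k := by
    have := (MvPolynomial.le_totalDegree hd).trans hP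
    rw [Finsupp.sum_fintype _ _ (by simp)] at this
    simpa [Fin.sum_univ_two] using this
  have h2 : DegLe (0 + (d 0 * 1 + d 1 * 1)) (fun x : ℝ × ℝ => MvPolynomial.coeff d P *
      (x.1 ^ d 0 * x.2 ^ d 1)) :=
    (DegLe.const _).mul (((DegLe.clm (ContinuousLinearMap.fst ℝ ℝ ℝ)).pow (d 0)).mul
      ((DegLe.clm (ContinuousLinearMap.snd ℝ ℝ ℝ)).pow (d 1)))
  simpa [Fin.prod_univ_two] using h2.mono (by omega : _ ≤ k)

lemma IsPolyMap.degLe {k : ℕ} {F : ℝ × ℝ → ℝ × ℝ} (hF : IsPolyMap k F) : DegLe k F := by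
  obtain ⟨P, Q, hP, hQ, h⟩ := hF
  have e : F = fun x => ContinuousLinearMap.inl ℝ ℝ ℝ (MvPolynomial.eval ![x.1, x.2] P) +
      ContinuousLinearMap.inr ℝ ℝ ℝ (MvPolynomial.eval ![x.1, x.2] Q) := by
    ext1 x; simp [h]
  have key : ∀ (L : ℝ →L[ℝ] ℝ × ℝ) (f : ℝ × ℝ → ℝ), DegLe k f → DegLe k (fun x => L (f x)) := by
    intro L f hf
    refine ⟨L.contDiff.comp hf.1, fun n hn x => ?_⟩
    rw [← norm_le_zero_iff]
    refine (L.norm_iteratedFDeriv_comp_left (hf.1.contDiffAt.toNat n) le_rfl).trans ?_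
    rw [hf.2 n hn]; simp
  rw [e]
  exact (key _ _ (DegLe.poly P hP)).add (key _ _ (DegLe.poly Q hQ))

end deg

section pointwise

lemma ScB.mono {E F : Type*} [NormedAddCommGroup E] [NormedSpace ℝ E]
    [NormedAddCommGroup F] [NormedSpace ℝ F] {N : ℕ} {h M M' : ℝ} (hh : 0 ≤ h) {f : E → F} {x : E}
    (hf : ScB N h M f x) (hM : M ≤ M') : ScB N h M' f x :=
  ⟨hf.1, fun l hl => (hf.2 l hl).trans (by gcongr)⟩

lemma ScB.const_smul {E F : Type*} [NormedAddCommGroup E] [NormedSpace ℝ E]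
    [NormedAddCommGroup F] [NormedSpace ℝ F] {N : ℕ} {h M : ℝ} {f : E → F} {x : E} {c : ℝ}
    (hc : 0 ≤ c) (hf : ScB N h M f x) : ScB N h (c * M) (fun y => c • f y) x := by
  refine ⟨contDiffAt_const.smul hf.1, fun l hl => ?_⟩
  have : iteratedFDeriv ℝ l (fun y => c • f y) x = c • iteratedFDeriv ℝ l f x :=
    iteratedFDeriv_const_smul_apply' (hf.1.toNat l)
  rw [this, norm_smul, Real.norm_of_nonneg hc, mul_assoc]
  gcongr
  exact hf.2 l hl

/-- The adjugate of a `2 × 2` matrix, `L ↦ tr(L) - L`, which is linear in `L`. -/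
def adjC : ((ℝ × ℝ) →L[ℝ] (ℝ × ℝ)) →L[ℝ] ((ℝ × ℝ) →L[ℝ] (ℝ × ℝ)) :=
  LinearMap.toContinuousLinearMap
    { toFun := fun L => ((L (1, 0)).1 + (L (0, 1)).2) • ContinuousLinearMap.id ℝ (ℝ × ℝ) - L
      map_add' := by
        intro L M
        simp only [_root_.add_apply, Prod.fst_add, Prod.snd_add]
        module
      map_smul' := by
        intro c L
        simp only [_root_.smul_apply, Prod.smul_fst, Prod.smul_snd, smul_eq_mul,
          RingHom.id_apply]
        module }

lemma adjC_apply (L : (ℝ × ℝ) →L[ℝ] (ℝ × ℝ)) (z : ℝ × ℝ) :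
    adjC L z = ((L (1, 0)).1 + (L (0, 1)).2) • z - L z := rfl

lemma det_formula (L : (ℝ × ℝ) →L[ℝ] (ℝ × ℝ)) :
    LinearMap.det (L : (ℝ × ℝ) →ₗ[ℝ] (ℝ × ℝ)) =
      (L (1, 0)).1 * (L (0, 1)).2 - (L (0, 1)).1 * (L (1, 0)).2 := by
  rw [← LinearMap.det_toMatrix (Module.Basis.finTwoProd ℝ), Matrix.det_fin_two]
  simp [LinearMap.toMatrix_apply]

lemma clm_decomp (L : (ℝ × ℝ) →L[ℝ] (ℝ × ℝ)) (z : ℝ × ℝ) :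
    L z = z.1 • L (1, 0) + z.2 • L (0, 1) := by
  rw [← map_smul, ← map_smul, ← map_add]; simp

lemma adjC_mul (L : (ℝ × ℝ) →L[ℝ] (ℝ × ℝ)) (z : ℝ × ℝ) :
    adjC L (L z) = LinearMap.det (L : (ℝ × ℝ) →ₗ[ℝ] (ℝ × ℝ)) • z := by
  rw [adjC_apply, det_formula, clm_decomp L (L z), clm_decomp L z]
  ext <;> simp <;> ring

lemma det_eq_adjC (L : (ℝ × ℝ) →L[ℝ] (ℝ × ℝ)) :
    LinearMap.det (L : (ℝ × ℝ) →ₗ[ℝ] (ℝ × ℝ)) = (L (adjC L (1, 0))).1 := by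
  rw [adjC_apply, det_formula, map_sub, clm_decomp L (L (1,0)), clm_decomp L (_ • (1,0))]
  simp; ring

lemma inv_bound (N : ℕ) (c₁ c₂ : ℝ) (hc₁ : 0 < c₁) :
    ∃ M : ℝ, 0 ≤ M ∧ ∀ t ∈ Icc c₁ c₂, ∀ l ≤ N,
      ‖iteratedFDeriv ℝ l (fun s : ℝ => s⁻¹) t‖ ≤ M := by
  have : ∀ l : ℕ, ∃ M : ℝ, ∀ t ∈ Icc c₁ c₂, ‖iteratedFDeriv ℝ l (fun s : ℝ => s⁻¹) t‖ ≤ M := by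
    intro l
    refine isCompact_Icc.exists_bound_of_continuousOn fun t ht => ?_
    have h0 : t ≠ 0 := (hc₁.trans_le ht.1).ne'
    exact ((contDiffAt_inv ℝ h0 (n := l)).continuousAt_iteratedFDeriv le_rfl).continuousWithinAt
  choose M hM using this
  refine ⟨∑ l ∈ Finset.range (N + 1), |M l|, by positivity, fun t ht l hl => ?_⟩
  refine (hM l t ht).trans ((le_abs_self _).trans ?_)
  exact Finset.single_le_sum (f := fun l => |M l|) (fun _ _ => abs_nonneg _)
    (Finset.mem_range.2 (by omega))

lemma DF_scb {k : ℕ} {CF c₁ c₂ h : ℝ} (hCF : 0 < CF) (hh : 0 < h)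
    {F : ℝ × ℝ → ℝ × ℝ} (hF : IsPolyMap k F) (hB : IsoparamBounds k CF c₁ c₂ h F) (N : ℕ)
    {x : ℝ × ℝ} (hx : x ∈ Tref) : ScB N h (CF * h) (fderiv ℝ F) x := by
  refine ⟨(hF.degLe.1.fderiv_right (m := ∞) (by simp)).contDiffAt, fun l hl => ?_⟩
  rw [norm_iteratedFDeriv_fderiv]
  by_cases hlk : l + 1 ≤ k
  · refine (hB.2.1 _ hlk x hx).trans_eq ?_
    ring
  · rw [hF.degLe.2 _ (by omega)]
    simp; positivity

lemma A_scb (k : ℕ) (CF c₁ c₂ : ℝ) (hCF : 0 < CF) (hc₁ : 0 < c₁) :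
    ∃ C : ℝ, 0 ≤ C ∧ ∀ h : ℝ, 0 < h → ∀ F : ℝ × ℝ → ℝ × ℝ, IsPolyMap k F →
      IsoparamBounds k CF c₁ c₂ h F → ∀ x ∈ Tref, ScB (k + 1) h (C * h⁻¹) (Amap F) x := by
  obtain ⟨Mi, hMi, hinv⟩ := inv_bound (k + 1) c₁ c₂ hc₁
  set N := k + 1
  set L₁ : ((ℝ × ℝ) →L[ℝ] (ℝ × ℝ)) →L[ℝ] ℝ × ℝ :=
    (ContinuousLinearMap.apply ℝ (ℝ × ℝ) ((1, 0) : ℝ × ℝ)).comp adjC with hL₁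
  set I := ContinuousLinearMap.id ℝ ((ℝ × ℝ) →L[ℝ] (ℝ × ℝ))
  set π := ContinuousLinearMap.fst ℝ ℝ ℝ
  set Cd : ℝ := ‖π‖ * (‖I‖ * 2 ^ N * CF * (‖L₁‖ * CF)) with hCd
  set D := max 1 Cd
  set S := ContinuousLinearMap.lsmul ℝ ℝ (E := (ℝ × ℝ) →L[ℝ] (ℝ × ℝ)) with hS
  refine ⟨‖S‖ * 2 ^ N * (N ! * D ^ N * Mi) * CF, by positivity, ?_⟩
  intro h hh F hF hB x hx
  have hDF := DF_scb hCF hh hF hB N hx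
  have h1 : ScB N h (Cd * h ^ 2) (jacDet F) x := by
    have := (hDF.bilin hh.le I (hDF.clm L₁)).clm π
    refine (this.congr (Filter.Eventually.of_forall fun y => ?_)).mono hh.le (le_of_eq ?_)
    · exact det_eq_adjC _
    · rw [hCd]; ring
  have h2 : ScB N h Cd (fun y => (h ^ 2)⁻¹ • jacDet F y) x := by
    refine (h1.const_smul (c := (h ^ 2)⁻¹) (by positivity)).mono hh.le (le_of_eq ?_)
    field_simp
  have hxc : x ∈ closure Tref := subset_closure hx
  obtain ⟨hd1, hd2⟩ := hB.2.2.2 x hxc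
  have hd : (h ^ 2)⁻¹ • jacDet F x ∈ Icc c₁ c₂ := by
    rw [smul_eq_mul, inv_mul_eq_div]
    exact ⟨by rwa [le_div_iff₀ (by positivity)], by rwa [div_le_iff₀ (by positivity)]⟩
  have h3 : ScB N h (N ! * D ^ N * Mi)
      ((fun s : ℝ => s⁻¹) ∘ (fun y => (h ^ 2)⁻¹ • jacDet F y)) x := by
    refine ScB.comp hh.le (le_max_left _ _) (contDiffAt_inv ℝ (hc₁.trans_le hd.1).ne')
      (fun l hl => hinv _ hd l hl) h2.1 (fun l _ hl => (h2.2 l hl).trans ?_)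
    gcongr
    exact le_max_right _ _
  have h4 := (h3.bilin hh.le S hDF).const_smul (c := (h ^ 2)⁻¹) (by positivity)
  refine (h4.congr (Filter.Eventually.of_forall fun y => ?_)).mono hh.le (le_of_eq ?_)
  · simp only [hS, Amap, Function.comp, ContinuousLinearMap.lsmul_apply, smul_smul]
    congr 1
    rw [smul_eq_mul, mul_inv, inv_inv]
    field_simp
  · field_simp

lemma isOpen_Tref : IsOpen Tref := by
  refine (isOpen_lt continuous_const continuous_fst).inter
    ((isOpen_lt continuous_const continuous_snd).inter
      (isOpen_lt (continuous_fst.add continuous_snd) continuous_const))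

lemma inv_smooth {F : ℝ × ℝ → ℝ × ℝ} (hF : ContDiff ℝ ∞ F) (hinj : InjOn F (closure Tref))
    {x : ℝ × ℝ} (hx : x ∈ Tref) (hd : jacDet F x ≠ 0) :
    ContDiffAt ℝ ∞ (invFunOn F (closure Tref)) (F x) ∧
      Filter.map F (𝓝 x) = 𝓝 (F x) := by
  have hder : HasFDerivAt F (fderiv ℝ F x) x :=
    (hF.differentiable (by simp)).differentiableAt.hasFDerivAt
  set e : (ℝ × ℝ) ≃L[ℝ] (ℝ × ℝ) :=
    (fderiv ℝ F x).toContinuousLinearEquivOfDetNeZero hd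
  have hder' : HasFDerivAt F (e : (ℝ × ℝ) →L[ℝ] (ℝ × ℝ)) x := by
    have he : (e : (ℝ × ℝ) →L[ℝ] (ℝ × ℝ)) = fderiv ℝ F x :=
      ContinuousLinearMap.coe_toContinuousLinearEquivOfDetNeZero _ hd
    rw [he]; exact hder
  have hs := hF.contDiffAt.hasStrictFDerivAt' (x := x) hder' (by simp)
  refine ⟨?_, hs.map_nhds_eq_of_equiv⟩
  refine (hF.contDiffAt.to_localInverse hder' (by simp)).congr_of_eventuallyEq ?_
  refine hs.localInverse_unique ?_
  filter_upwards [isOpen_Tref.mem_nhds hx] with z hz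
  exact hinj.leftInvOn_invFunOn (subset_closure hz)

lemma pull_bound (k : ℕ) (CF c₁ c₂ : ℝ) (hCF : 0 < CF) (hc₁ : 0 < c₁) :
    ∃ C : ℝ, 0 < C ∧ ∀ h : ℝ, 0 < h → ∀ F : ℝ × ℝ → ℝ × ℝ, IsPolyMap k F →
      IsoparamBounds k CF c₁ c₂ h F → ∀ x ∈ Tref, ∀ u v : ℝ × ℝ → ℝ × ℝ,
      ContDiffAt ℝ ∞ u x → (∀ z ∈ closure Tref, v (F z) = u z) →
      ContDiffAt ℝ ∞ v (F x) ∧ ∀ l ≤ k, ‖iteratedFDeriv ℝ l v (F x)‖ ≤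
        C * (h ^ l)⁻¹ * ∑ m ∈ Finset.range (l + 1), ‖iteratedFDeriv ℝ m u x‖ := by
  refine ⟨k ! * (max 1 CF) ^ k, by positivity, ?_⟩
  intro h hh F hF hB x hx u v hu hv
  have hxc := subset_closure hx
  have hd : jacDet F x ≠ 0 := ((by positivity : 0 < c₁ * h ^ 2).trans_le (hB.2.2.2 x hxc).1).ne'
  obtain ⟨hG, hmap⟩ := inv_smooth hF.degLe.1 hB.1 hx hd
  set G := invFunOn F (closure Tref) with hGdef
  have hGF : ∀ z ∈ closure Tref, G (F z) = z := fun z hz => hB.1.leftInvOn_invFunOn hz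
  have hvG : v =ᶠ[𝓝 (F x)] u ∘ G := by
    rw [← hmap]
    refine Filter.eventually_map.2 ?_
    filter_upwards [isOpen_Tref.mem_nhds hx] with z hz
    rw [hv z (subset_closure hz), Function.comp, hGF z (subset_closure hz)]
  have hu' : ContDiffAt ℝ ∞ u (G (F x)) := by rwa [hGF x hxc]
  have key : ∀ l ≤ k, ScB l h⁻¹ (l ! * (max 1 CF) ^ l *
      ∑ m ∈ Finset.range (l + 1), ‖iteratedFDeriv ℝ m u x‖) v (F x) := by
    intro l hl
    refine ScB.congr ?_ hvG
    refine ScB.comp (by positivity) (le_max_left _ _) hu' ?_ hG ?_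
    · intro m hm
      rw [hGF x hxc]
      exact Finset.single_le_sum (f := fun m => ‖iteratedFDeriv ℝ m u x‖)
        (fun _ _ => norm_nonneg _) (Finset.mem_range.2 (by omega))
    · intro m _ hm
      refine (hB.2.2.1 m (by omega) _ ⟨x, hx, rfl⟩).trans ?_
      rw [zpow_neg, zpow_natCast, inv_pow]
      gcongr
      exact le_max_right _ _
  refine ⟨(key 0 (Nat.zero_le _)).1, fun l hl => ?_⟩
  refine ((key l hl).2 l le_rfl).trans ?_
  rw [inv_pow]
  have h1 : (l ! : ℝ) ≤ k ! := by exact_mod_cast Nat.factorial_le hl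
  have h2 : (max 1 CF) ^ l ≤ (max 1 CF) ^ k := pow_le_pow_right₀ (le_max_left _ _) hl
  calc _ ≤ k ! * (max 1 CF) ^ k * (∑ m ∈ Finset.range (l + 1), ‖iteratedFDeriv ℝ m u x‖)
        * (h ^ l)⁻¹ := by gcongr
    _ = _ := by ring

lemma push_bound (k : ℕ) (CF c₁ c₂ : ℝ) (hCF : 0 < CF) (hc₁ : 0 < c₁) :
    ∃ C : ℝ, 0 < C ∧ ∀ h : ℝ, 0 < h → ∀ F : ℝ × ℝ → ℝ × ℝ, IsPolyMap k F →
      IsoparamBounds k CF c₁ c₂ h F → ∀ x ∈ Tref, ∀ vh v : ℝ × ℝ → ℝ × ℝ,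
      IsPolyMap k vh → IsPiola F vh v →
      ‖iteratedFDeriv ℝ (k + 1) (fun y => Amap F y (vh y)) x‖ ≤
        C * h ^ (k + 1) * ∑ l ∈ Finset.range (k + 1), ‖iteratedFDeriv ℝ l v (F x)‖ := by
  obtain ⟨CA, hCA, hA⟩ := A_scb k CF c₁ c₂ hCF hc₁
  obtain ⟨Cp, hCp, hpull⟩ := pull_bound k CF c₁ c₂ hCF hc₁
  set I := ContinuousLinearMap.id ℝ ((ℝ × ℝ) →L[ℝ] (ℝ × ℝ)) with hI
  set D := max 1 CF with hD
  set C₀ : ℝ := ‖I‖ * 2 ^ (k + 1) * CA * (‖I‖ * 2 ^ k * (‖adjC‖ * CF) * (k ! * D ^ k)) with hC₀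
  have hC₀' : 0 ≤ C₀ := by positivity
  refine ⟨C₀ + 1, by positivity, ?_⟩
  intro h hh F hF hB x hx vh v hvh hv
  have hxc := subset_closure hx
  have hAx := hA h hh F hF hB x hx
  have hu : ContDiffAt ℝ ∞ (fun y => Amap F y (vh y)) x :=
    hAx.1.clm_apply hvh.degLe.1.contDiffAt
  have hvs := (hpull h hh F hF hB x hx _ v hu hv).1
  set S := ∑ l ∈ Finset.range (k + 1), ‖iteratedFDeriv ℝ l v (F x)‖ with hS
  have hS0 : 0 ≤ S := by positivity
  have h1 : ScB k h (k ! * D ^ k * S) (v ∘ F) x := by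
    refine ScB.comp hh.le (le_max_left _ _) hvs ?_ hF.degLe.1.contDiffAt ?_
    · intro m hm
      exact Finset.single_le_sum (f := fun m => ‖iteratedFDeriv ℝ m v (F x)‖)
        (fun _ _ => norm_nonneg _) (Finset.mem_range.2 (by omega))
    · intro m _ hm
      refine (hB.2.1 m hm x hx).trans ?_
      gcongr
      exact le_max_right _ _
  have h2 := ((DF_scb hCF hh hF hB k hx).clm adjC).bilin hh.le I h1
  have h3 : ScB k h (‖I‖ * 2 ^ k * (‖adjC‖ * (CF * h)) * (k ! * D ^ k * S)) vh x := by
    refine h2.congr ?_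
    filter_upwards [isOpen_Tref.mem_nhds hx] with z hz
    have hzc := subset_closure hz
    have hd : jacDet F z ≠ 0 := ((by positivity : 0 < c₁ * h ^ 2).trans_le (hB.2.2.2 z hzc).1).ne'
    simp only [hI, ContinuousLinearMap.id_apply, Function.comp]
    rw [hv z hzc, Amap, _root_.smul_apply, map_smul, adjC_mul]
    change _ = (jacDet F z)⁻¹ • jacDet F z • vh z
    rw [inv_smul_smul₀ hd]
  have h4 : ScB (k + 1) h (‖I‖ * 2 ^ k * (‖adjC‖ * (CF * h)) * (k ! * D ^ k * S)) vh x := ⟨h3.1, fun l hl => by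
    rcases Nat.lt_or_ge k l with hl' | hl'
    · rw [hvh.degLe.2 l hl', norm_zero]
      exact mul_nonneg h3.nonneg (by positivity)
    · exact h3.2 l hl'⟩
  have h5 := (hAx.bilin hh.le I h4).2 (k + 1) le_rfl
  refine h5.trans ?_
  calc _ = C₀ * h ^ (k + 1) * S := by rw [hC₀]; field_simp
    _ ≤ _ := by gcongr; linarith

end pointwise

section integration

lemma semiLp_two {E : Type*} [NormedAddCommGroup E] [NormedSpace ℝ E]
    (m : ℕ) (w : ℝ × ℝ → E) (S : Set (ℝ × ℝ)) :
    semiLp m 2 w S = √(∫ x in S, ‖iteratedFDeriv ℝ m w x‖ ^ 2) := by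
  rw [semiLp, Real.sqrt_eq_rpow]
  simp only [Real.rpow_two]

lemma l2_le {K : Set (ℝ × ℝ)} (hK : MeasurableSet K) (n : ℕ) (f : ℝ × ℝ → ℝ)
    (g : ℕ → ℝ × ℝ → ℝ) (c : ℝ) (hc : 0 ≤ c) (hf0 : ∀ x ∈ K, 0 ≤ f x)
    (hfg : ∀ x ∈ K, f x ≤ c * ∑ m ∈ Finset.range n, g m x)
    (hg : ∀ m < n, IntegrableOn (fun x => g m x ^ 2) K) :
    √(∫ x in K, f x ^ 2) ≤ c * √n * ∑ m ∈ Finset.range n, √(∫ x in K, g m x ^ 2) := by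
  have hI : IntegrableOn (fun x => c ^ 2 * n * ∑ m ∈ Finset.range n, g m x ^ 2) K := by
    refine Integrable.const_mul ?_ _
    exact integrable_finsetSum _ fun m hm => hg m (Finset.mem_range.1 hm)
  have h1 : ∫ x in K, f x ^ 2 ≤ ∫ x in K, c ^ 2 * n * ∑ m ∈ Finset.range n, g m x ^ 2 := by
    refine integral_mono_of_nonneg (Filter.Eventually.of_forall fun x => sq_nonneg _) hI ?_
    filter_upwards [ae_restrict_mem hK] with x hx
    have h2 : f x ^ 2 ≤ (c * ∑ m ∈ Finset.range n, g m x) ^ 2 :=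
      pow_le_pow_left₀ (hf0 x hx) (hfg x hx) 2
    have h3 := sq_sum_le_card_mul_sum_sq (s := Finset.range n) (f := fun m => g m x)
    rw [Finset.card_range] at h3
    calc f x ^ 2 ≤ c ^ 2 * (∑ m ∈ Finset.range n, g m x) ^ 2 := by rw [← mul_pow]; exact h2
      _ ≤ c ^ 2 * (n * ∑ m ∈ Finset.range n, g m x ^ 2) := by gcongr
      _ = _ := by ring
  rw [integral_const_mul, integral_finsetSum _ fun m hm => hg m (Finset.mem_range.1 hm)] at h1
  have h0 : ∀ m, 0 ≤ ∫ x in K, g m x ^ 2 := fun m => integral_nonneg fun x => sq_nonneg _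
  refine Real.sqrt_le_iff.2 ⟨by positivity, h1.trans ?_⟩
  rw [mul_pow, mul_pow, Real.sq_sqrt (Nat.cast_nonneg n)]
  gcongr
  calc ∑ m ∈ Finset.range n, ∫ x in K, g m x ^ 2
      = ∑ m ∈ Finset.range n, √(∫ x in K, g m x ^ 2) ^ 2 :=
        Finset.sum_congr rfl fun m _ => (Real.sq_sqrt (h0 m)).symm
    _ ≤ _ := Finset.sum_sq_le_sq_sum_of_nonneg fun m _ => Real.sqrt_nonneg _

lemma ctK_subset (j : Fin 3) : ctK j ⊆ Tref := by
  set s : (ℝ × ℝ) →L[ℝ] ℝ := ContinuousLinearMap.fst ℝ ℝ ℝ + ContinuousLinearMap.snd ℝ ℝ ℝ with hs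
  have hsurj : Function.Surjective s := fun t => ⟨(t, 0), by simp [hs]⟩
  set T : Set (ℝ × ℝ) := Prod.fst ⁻¹' Ici 0 ∩ (Prod.snd ⁻¹' Ici 0 ∩ s ⁻¹' Iic 1) with hT
  have hconv : Convex ℝ T := by
    refine ((convex_Ici 0).is_linear_preimage (LinearMap.fst ℝ ℝ ℝ).isLinear).inter
      (((convex_Ici 0).is_linear_preimage (LinearMap.snd ℝ ℝ ℝ).isLinear).inter
        ((convex_Iic 1).is_linear_preimage s.toLinearMap.isLinear))
  have hsub : convexHull ℝ {vtx j, vtx (j + 1), ((1 : ℝ) / 3, (1 : ℝ) / 3)} ⊆ T := by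
    refine convexHull_min ?_ hconv
    intro p hp
    simp only [mem_insert_iff, mem_singleton_iff] at hp
    rcases hp with rfl | rfl | rfl
    · fin_cases j <;> simp [vtx, hT, hs]
    · fin_cases j <;> simp [vtx, hT, hs]
    · simp [hT, hs]; norm_num
  have hintg : interior T ⊆ Tref := by
    rw [hT, interior_inter, interior_inter,
      ← isOpenMap_fst.preimage_interior_eq_interior_preimage continuous_fst,
      ← isOpenMap_snd.preimage_interior_eq_interior_preimage continuous_snd,
      ← (s.isOpenMap hsurj).preimage_interior_eq_interior_preimage s.continuous,
      interior_Ici, interior_Iic]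
    rintro x ⟨h1, h2, h3⟩
    exact ⟨h1, h2, h3⟩
  exact (interior_mono hsub).trans hintg

lemma isCompact_closure_Tref : IsCompact (closure Tref) := by
  refine (isCompact_Icc (a := ((0 : ℝ), (0 : ℝ))) (b := ((1 : ℝ), (1 : ℝ)))).closure_of_subset ?_
  rintro x ⟨h1, h2, h3⟩
  exact ⟨⟨h1.le, h2.le⟩, ⟨by simp; linarith, by simp; linarith⟩⟩

lemma integrable_sq {K : Set (ℝ × ℝ)} (hK : K ⊆ Tref) {u : ℝ × ℝ → ℝ × ℝ}
    (hu : ∀ x ∈ closure Tref, ContDiffAt ℝ ∞ u x) (m : ℕ) :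
    IntegrableOn (fun x => ‖iteratedFDeriv ℝ m u x‖ ^ 2) K := by
  have : ContinuousOn (fun x => ‖iteratedFDeriv ℝ m u x‖ ^ 2) (closure Tref) := by
    intro x hx
    exact ((((hu x hx).toNat m).continuousAt_iteratedFDeriv le_rfl).norm.pow 2).continuousWithinAt
  exact (this.integrableOn_compact isCompact_closure_Tref).mono_set (hK.trans subset_closure)

lemma jacDet_contDiff {F : ℝ × ℝ → ℝ × ℝ} (hF : ContDiff ℝ ∞ F) : ContDiff ℝ ∞ (jacDet F) := by
  have h1 : ContDiff ℝ ∞ (fderiv ℝ F) := hF.fderiv_right (m := ∞) (by simp)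
  have h2 : jacDet F = fun x => (fderiv ℝ F x (adjC (fderiv ℝ F x) (1, 0))).1 := by
    ext1 x; exact det_eq_adjC _
  rw [h2]
  exact (h1.clm_apply ((adjC.contDiff.comp h1).clm_apply contDiff_const)).fst

lemma semiLp_image {F : ℝ × ℝ → ℝ × ℝ} (hF : ContDiff ℝ ∞ F) {K : Set (ℝ × ℝ)}
    (hK : MeasurableSet K) (hinj : InjOn F K) (hd : ∀ x ∈ K, 0 ≤ jacDet F x)
    (m : ℕ) (w : ℝ × ℝ → ℝ × ℝ) :
    semiLp m 2 w (F '' K) =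
      √(∫ x in K, (√(jacDet F x) * ‖iteratedFDeriv ℝ m w (F x)‖) ^ 2) := by
  rw [semiLp_two, integral_image_eq_integral_abs_det_fderiv_smul volume hK
    (fun x _ => (hF.differentiable (by simp)).differentiableAt.hasFDerivAt.hasFDerivWithinAt) hinj]
  congr 1
  refine setIntegral_congr_fun hK fun x hx => ?_
  have e : (fderiv ℝ F x).det = jacDet F x := rfl
  simp only [e]
  rw [mul_pow, Real.sq_sqrt (hd x hx), abs_of_nonneg (hd x hx), smul_eq_mul]

end integration

/-- If `ŵ` is a polynomial approximation of `A v̂` on the subtriangle `K̂ⱼ` with Bramble–Hilbert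
constant `C_BH`, then `|v − w|_{H^i(F(K̂ⱼ))} ≤ C h^{k+1−i} ‖v‖_{H^k(F(K̂ⱼ))}` for the Piola
transform `v` of `v̂` and `w = ŵ ∘ F⁻¹`. -/
theorem stmt15 (k i : ℕ) (hk : 2 ≤ k) (hi : i ≤ k)
    (CBH : ℝ) (hCBH : 0 < CBH)
    (CF c₁ c₂ : ℝ) (hCF : 0 < CF) (hc₁ : 0 < c₁) (hc₂ : 0 < c₂) :
    ∃ C : ℝ, 0 < C ∧ ∀ h : ℝ, h ∈ Set.Ioc (0 : ℝ) 1 → ∀ F : ℝ × ℝ → ℝ × ℝ,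
      IsPolyMap k F → IsoparamBounds k CF c₁ c₂ h F →
      ∀ vhat : ℝ × ℝ → ℝ × ℝ, IsPolyMap k vhat →
      ∀ j : Fin 3,
      ∀ what : ℝ × ℝ → ℝ × ℝ, IsPolyMap k what →
        normWmp i 2 (fun x => Amap F x (vhat x) - what x) (ctK j) ≤
          CBH * semiLp (k + 1) 2 (fun x => Amap F x (vhat x)) (ctK j) →
      ∀ v w : ℝ × ℝ → ℝ × ℝ, IsPiola F vhat v →
        (∀ x ∈ closure Tref, w (F x) = what x) →
        semiLp i 2 (fun y => v y - w y) (F '' ctK j) ≤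
          C * h ^ (k + 1 - i) * normWmp k 2 v (F '' ctK j) := by
  obtain ⟨Cp, hCp, hpull⟩ := pull_bound k CF c₁ c₂ hCF hc₁
  obtain ⟨Cq, hCq, hpush⟩ := push_bound k CF c₁ c₂ hCF hc₁
  refine ⟨√c₂ * Cp * √((i + 1 : ℕ) : ℝ) * (CBH * (Cq * (√c₁)⁻¹ * √((k + 1 : ℕ) : ℝ))), by positivity, ?_⟩
  intro h hh F hF hB vhat hvhat j what hwhat hBH v w hv hw
  have h0 : 0 < h := hh.1
  have hKT := ctK_subset j
  have hKo : IsOpen (ctK j) := isOpen_interior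
  have hKm := hKo.measurableSet
  set K := ctK j
  have hKc : K ⊆ closure Tref := hKT.trans subset_closure
  have hFs := hF.degLe.1
  have hinj : InjOn F K := hB.1.mono hKc
  have hdlow : ∀ x ∈ closure Tref, c₁ * h ^ 2 ≤ jacDet F x := fun x hx => (hB.2.2.2 x hx).1
  have hdup : ∀ x ∈ closure Tref, jacDet F x ≤ c₂ * h ^ 2 := fun x hx => (hB.2.2.2 x hx).2
  have hdpos : ∀ x ∈ closure Tref, 0 < jacDet F x := fun x hx =>
    (by positivity : 0 < c₁ * h ^ 2).trans_le (hdlow x hx)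
  have hJ := jacDet_contDiff hFs
  set u : ℝ × ℝ → ℝ × ℝ := fun x => Amap F x (vhat x) with hu
  have hus : ∀ x ∈ closure Tref, ContDiffAt ℝ ∞ u x := by
    intro x hx
    have h1 : ContDiff ℝ ∞ (fderiv ℝ F) := hFs.fderiv_right (m := ∞) (by simp)
    exact ((hJ.contDiffAt.inv (hdpos x hx).ne').smul h1.contDiffAt).clm_apply
      hvhat.degLe.1.contDiffAt
  have hgs : ∀ x ∈ closure Tref, ContDiffAt ℝ ∞ (fun x => u x - what x) x := fun x hx =>
    (hus x hx).sub hwhat.degLe.1.contDiffAt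
  have hsqu : ∀ x ∈ K, √(jacDet F x) ≤ √c₂ * h := by
    intro x hx
    rw [← Real.sqrt_sq h0.le, ← Real.sqrt_mul hc₂.le]
    exact Real.sqrt_le_sqrt (hdup x (hKc hx))
  have hsql : ∀ x ∈ K, √c₁ * h ≤ √(jacDet F x) := by
    intro x hx
    rw [← Real.sqrt_sq h0.le, ← Real.sqrt_mul hc₁.le]
    exact Real.sqrt_le_sqrt (hdlow x (hKc hx))
  -- first estimate
  have hX : semiLp i 2 (fun y => v y - w y) (F '' K) ≤
      (√c₂ * h * (Cp * (h ^ i)⁻¹)) * √((i + 1 : ℕ) : ℝ) *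
        normWmp i 2 (fun x => u x - what x) K := by
    rw [semiLp_image hFs hKm hinj (fun x hx => (hdpos x (hKc hx)).le)]
    simp only [normWmp, semiLp_two]
    refine l2_le hKm (i + 1) _ (fun m x => ‖iteratedFDeriv ℝ m (fun x => u x - what x) x‖) _
      (by positivity) (fun x hx => by positivity) ?_ (fun m _ => integrable_sq hKT hgs m)
    intro x hx
    have hp := (hpull h h0 F hF hB x (hKT hx) (fun x => u x - what x) (fun y => v y - w y)
      (hgs x (hKc hx)) (fun z hz => by rw [hv z hz, hw z hz])).2 i hi
    calc _ ≤ (√c₂ * h) * (Cp * (h ^ i)⁻¹ * ∑ m ∈ Finset.range (i + 1),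
          ‖iteratedFDeriv ℝ m (fun x => u x - what x) x‖) :=
          mul_le_mul (hsqu x hx) hp (norm_nonneg _) (by positivity)
      _ = _ := by ring
  -- second estimate
  have hintg : ∀ l ≤ k, IntegrableOn
      (fun x => (√(jacDet F x) * ‖iteratedFDeriv ℝ l v (F x)‖) ^ 2) K := by
    intro l hl
    have hdom : IntegrableOn (fun x => (√c₂ * h * (Cp * (h ^ l)⁻¹)) ^ 2 * ((l + 1 : ℕ) *
        ∑ m ∈ Finset.range (l + 1), ‖iteratedFDeriv ℝ m u x‖ ^ 2)) K := by
      refine Integrable.const_mul (Integrable.const_mul ?_ _) _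
      exact integrable_finsetSum _ fun m _ => integrable_sq hKT hus m
    refine Integrable.mono' hdom ?_ ?_
    · refine ContinuousOn.aestronglyMeasurable ?_ hKm
      intro x hx
      have hvx := (hpull h h0 F hF hB x (hKT hx) u v (hus x (hKc hx)) hv).1
      have hc := (hvx.toNat l).continuousAt_iteratedFDeriv le_rfl
      have hc2 : ContinuousAt (fun x => iteratedFDeriv ℝ l v (F x)) x :=
        ContinuousAt.comp (f := F) hc hFs.continuous.continuousAt
      exact (((hJ.continuous.sqrt.continuousAt).mul hc2.norm).pow 2).continuousWithinAt
    · filter_upwards [ae_restrict_mem hKm] with x hx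
      have hp := (hpull h h0 F hF hB x (hKT hx) u v (hus x (hKc hx)) hv).2 l hl
      rw [Real.norm_of_nonneg (sq_nonneg _)]
      have h3 := sq_sum_le_card_mul_sum_sq (s := Finset.range (l + 1))
        (f := fun m => ‖iteratedFDeriv ℝ m u x‖)
      rw [Finset.card_range] at h3
      calc _ ≤ ((√c₂ * h) * (Cp * (h ^ l)⁻¹ * ∑ m ∈ Finset.range (l + 1),
            ‖iteratedFDeriv ℝ m u x‖)) ^ 2 :=
            pow_le_pow_left₀ (by positivity)
              (mul_le_mul (hsqu x hx) hp (norm_nonneg _) (by positivity)) 2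
        _ = (√c₂ * h * (Cp * (h ^ l)⁻¹)) ^ 2 * (∑ m ∈ Finset.range (l + 1),
            ‖iteratedFDeriv ℝ m u x‖) ^ 2 := by ring
        _ ≤ _ := by gcongr
  have hY : semiLp (k + 1) 2 u K ≤
      (Cq * h ^ (k + 1) * (√c₁ * h)⁻¹) * √((k + 1 : ℕ) : ℝ) * normWmp k 2 v (F '' K) := by
    have e : normWmp k 2 v (F '' K) = ∑ l ∈ Finset.range (k + 1),
        √(∫ x in K, (√(jacDet F x) * ‖iteratedFDeriv ℝ l v (F x)‖) ^ 2) :=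
      Finset.sum_congr rfl fun l _ =>
        semiLp_image hFs hKm hinj (fun x hx => (hdpos x (hKc hx)).le) l v
    rw [e, semiLp_two]
    refine l2_le hKm (k + 1) _ (fun l x => √(jacDet F x) * ‖iteratedFDeriv ℝ l v (F x)‖) _
      (by positivity) (fun x hx => norm_nonneg _) ?_ (fun m hm => hintg m (by omega))
    intro x hx
    refine (hpush h h0 F hF hB x (hKT hx) vhat v hvhat hv).trans ?_
    have h1 : 1 ≤ (√c₁ * h)⁻¹ * √(jacDet F x) := by
      rw [inv_mul_eq_div, one_le_div (by positivity)]
      exact hsql x hx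
    rw [← Finset.mul_sum]
    calc Cq * h ^ (k + 1) * ∑ l ∈ Finset.range (k + 1), ‖iteratedFDeriv ℝ l v (F x)‖
        ≤ (Cq * h ^ (k + 1) * ∑ l ∈ Finset.range (k + 1), ‖iteratedFDeriv ℝ l v (F x)‖) *
          ((√c₁ * h)⁻¹ * √(jacDet F x)) := le_mul_of_one_le_right (by positivity) h1
      _ = _ := by ring
  have hpow : h ^ (k + 1 - i) = h * (h ^ i)⁻¹ * (h ^ (k + 1) * h⁻¹) := by
    have : h ^ (k + 1) = h ^ (k + 1 - i) * h ^ i := by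
      rw [← pow_add]; congr 1; omega
    rw [this]; field_simp
  calc _ ≤ _ := hX
    _ ≤ (√c₂ * h * (Cp * (h ^ i)⁻¹)) * √((i + 1 : ℕ) : ℝ) * (CBH * ((Cq * h ^ (k + 1) *
        (√c₁ * h)⁻¹) * √((k + 1 : ℕ) : ℝ) * normWmp k 2 v (F '' K))) := by
        refine mul_le_mul_of_nonneg_left (hBH.trans ?_) (by positivity)
        exact mul_le_mul_of_nonneg_left hY hCBH.le
    _ = _ := by
        rw [hpow, mul_inv]; ring
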